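/- Let 𝐬 = ([i_1,j_1],…,[i_r,j_r]) ∈ 𝐒ˢ be prime with r ≥ 3, N = N(𝐬), ξ = ξ_𝐬, s_m = p_{r−m+1}, and for 1 ≤ t ≤ N set i^ξ_t = (ξ(t) − t)/2 and j^ξ_t = (ξ(t) + t)/2. Let 𝐬_ξ = ([i^ξ_{s_1} − ε_1, j^ξ_{s_1} − ε_1],…,[i^ξ_{s_r} − ε_r, j^ξ_{s_r} − ε_r]) with signs ε_1,…,ε_r (a prime element of 𝐒ˢ ∩ 𝕀_N^r). Then {[i^ξ_t, j^ξ_t] : 1 ≤ t ≤ N} ∪ {[i^ξ_t − 1, j^ξ_t − 1] : 1 ≤ t ≤ N} = 𝕀_N(𝐬_ξ). -/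

import Mathlib

/-- The interval `[a,b]` belongs to `𝕀ₙ` (integer intervals with `0 ≤ b - a ≤ n+1`). -/
def InIntv (n : ℕ) (a b : ℤ) : Prop := 0 ≤ b - a ∧ b - a ≤ (n : ℤ) + 1

/-- `([i 1, j 1], …, [i r, j r])` together with signs `ε 1, …, ε r ∈ {0,1}` is a
stable alternating snake of sink–source type (`𝐬 ∈ 𝐒ˢ`). -/
def IsSnake (n r : ℕ) (i j : ℕ → ℤ) (ε : ℕ → ℕ) : Prop :=
  (∀ s, 1 ≤ s → s ≤ r → InIntv n (i s) (j s)) ∧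
  (∀ s, 1 ≤ s → s ≤ r → ε s ≤ 1) ∧
  (∀ s p, 1 ≤ s → s < p → p ≤ r → ¬(i s = i p ∧ j s = j p)) ∧
  (∀ p, 1 ≤ p → p + 1 ≤ r →
    ε p + ε (p + 1) = 1 ∧ i (p + 1 - ε p) < i (p + ε p) ∧ j (p + 1 - ε p) < j (p + ε p)) ∧
  (∀ p s, 1 ≤ p → p + 2 ≤ s → s ≤ r → i p ≤ i s ∧ i s < j s ∧ j s ≤ j p)

/-- The snake `𝐬` is connected. -/
def IsConnectedSnake (n r : ℕ) (i j : ℕ → ℤ) (ε : ℕ → ℕ) : Prop :=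
  IsSnake n r i j ε ∧
  ∀ p, 1 ≤ p → p + 1 ≤ r →
    i (p + 1 - ε p) < i (p + ε p) ∧ i (p + ε p) ≤ j (p + 1 - ε p) ∧
      j (p + 1 - ε p) < j (p + ε p) ∧ j (p + ε p) - i (p + 1 - ε p) ≤ (n : ℤ) + 1

/-- The snake `𝐬` is prime. -/
def IsPrimeSnake (n r : ℕ) (i j : ℕ → ℤ) (ε : ℕ → ℕ) : Prop :=
  IsConnectedSnake n r i j ε ∧
  ∀ s, 1 ≤ s → s + 2 ≤ r → i s ≠ i (s + 2) ∧ j s ≠ j (s + 2)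

/-- Membership of the interval `[a,b]` in `Ĩₙ(𝐬)`. -/
def ItildeMem (n r : ℕ) (i j : ℕ → ℤ) (ε : ℕ → ℕ) (a b : ℤ) : Prop :=
  InIntv n a b ∧
  ∃ p ℓ, 1 ≤ p ∧ p ≤ r ∧ 1 ≤ ℓ ∧ ℓ ≤ r ∧
    (ℓ + 1 + ε p = p ∨ ℓ + ε p = p ∨ ℓ + ε p = p + 1 ∨ ℓ + ε p = p + 2) ∧
    a = i p ∧ b = j ℓ

/-- Membership of the interval `[a,b]` in `𝕀ₙ(𝐬)`. -/
def IMem (n r : ℕ) (i j : ℕ → ℤ) (ε : ℕ → ℕ) (a b : ℤ) : Prop :=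
  ItildeMem n r i j ε a b ∧ b ≠ a ∧ b ≠ a + (n : ℤ) + 1

/-- The intervals `[a,b]` and `[c,d]` form a connected pair. -/
def ConnPair (n : ℕ) (a b c d : ℤ) : Prop :=
  min a c < max a c ∧ max a c ≤ min b d ∧ min b d < max b d ∧
    max b d - min a c ≤ (n : ℤ) + 1

/-- `N(𝐬) = r + #{2 ≤ s ≤ r-2 : i (s-1) ≠ i (s+2) and j (s-1) ≠ j (s+2)}`. -/
def Nval (r : ℕ) (i j : ℕ → ℤ) : ℕ :=
  r + ((Finset.Icc 2 (r - 2)).filter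
    (fun s => i (s - 1) ≠ i (s + 2) ∧ j (s - 1) ≠ j (s + 2))).card

/-- The sequence `p_1, …, p_r` attached to a prime snake:
`p 1 = 1`, `p 2 = 2`, `p r = p (r-1) + 1`, and for `2 ≤ m ≤ r-2`,
`p (m+1) = p m + 2` if `i (r-m+2) ≠ i (r-m-1)` and `j (r-m+2) ≠ j (r-m-1)`,
and `p (m+1) = p m + 1` otherwise. -/
def pSeq (r : ℕ) (i j : ℕ → ℤ) : ℕ → ℕ
  | 0 => 0
  | 1 => 1
  | 2 => 2
  | m + 3 =>
    pSeq r i j (m + 2) +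
      (if m + 3 = r then 1
       else if i (r - m) ≠ i (r - m - 3) ∧ j (r - m) ≠ j (r - m - 3) then 2 else 1)

/-- The defining conditions of the height function `ξ = ξ_𝐬 : {1,…,N} → ℤ`. -/
def HeightCond (r N : ℕ) (p ε : ℕ → ℕ) (ξ : ℕ → ℤ) : Prop :=
  (∀ t, 1 ≤ t → t + 1 ≤ N → |ξ (t + 1) - ξ t| ≤ 1) ∧
  ξ (p r) = (p r : ℤ) ∧
  (∀ m, 1 ≤ m → m ≤ r → 2 ≤ p m → p m + 1 ≤ N → ξ (p m - 1) = ξ (p m + 1)) ∧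
  (∀ m, 1 ≤ m → m + 1 ≤ r →
    ξ (p (m + 1 - ε (r - m))) - ξ (p (m + ε (r - m))) = (p (m + 1) : ℤ) - (p m : ℤ))

/-- `s_m = p_{r-m+1}`. -/
def sIdx (r : ℕ) (i j : ℕ → ℤ) (m : ℕ) : ℕ := pSeq r i j (r - m + 1)

/-- `i'_{s_m} = (ξ(s_m) - s_m)/2 - ε_m`. -/
def iPr (r : ℕ) (i j : ℕ → ℤ) (ε : ℕ → ℕ) (ξ : ℕ → ℤ) (m : ℕ) : ℤ :=
  (ξ (sIdx r i j m) - (sIdx r i j m : ℤ)) / 2 - (ε m : ℤ)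

/-- `j'_{s_m} = (ξ(s_m) + s_m)/2 - ε_m`. -/
def jPr (r : ℕ) (i j : ℕ → ℤ) (ε : ℕ → ℕ) (ξ : ℕ → ℤ) (m : ℕ) : ℤ :=
  (ξ (sIdx r i j m) + (sIdx r i j m : ℤ)) / 2 - (ε m : ℤ)

theorem pSeq_succ (r : ℕ) (i j : ℕ → ℤ) (k : ℕ) (hk : 1 ≤ k) (hkr : k + 1 ≤ r) :
    pSeq r i j (k + 1) = pSeq r i j k + 1 ∨
      (pSeq r i j (k + 1) = pSeq r i j k + 2 ∧ 2 ≤ k ∧ k + 2 ≤ r) := by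
  match k, hk with
  | 1, _ => left; rfl
  | k + 2, _ =>
    rw [pSeq]
    split_ifs with h1 h2
    · left; rfl
    · right; exact ⟨rfl, by omega, by omega⟩
    · left; rfl

theorem pSeq_mono (r : ℕ) (i j : ℕ → ℤ) {k l : ℕ} (hk : 1 ≤ k) (hkl : k ≤ l)
    (hl : l ≤ r) : pSeq r i j k ≤ pSeq r i j l := by
  induction l, hkl using Nat.le_induction with
  | base => exact le_rfl
  | succ l hkl ih =>
    have := pSeq_succ r i j l (by omega) hl
    have := ih (by omega)
    omega

/-- Every `t ≤ p_k` is some `p_l`, or lies strictly inside a gap of length two. -/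
theorem pSeq_cover (r : ℕ) (i j : ℕ → ℤ) (k : ℕ) (hk : 1 ≤ k) (hkr : k ≤ r)
    (t : ℕ) (ht : 1 ≤ t) (htk : t ≤ pSeq r i j k) :
    ∃ l, 1 ≤ l ∧ l ≤ r ∧ (t = pSeq r i j l ∨
      (l + 1 ≤ r ∧ t = pSeq r i j l + 1 ∧ pSeq r i j (l + 1) = pSeq r i j l + 2)) := by
  induction k, hk using Nat.le_induction with
  | base =>
    have h1 : pSeq r i j 1 = 1 := rfl
    exact ⟨1, le_rfl, hkr, by omega⟩
  | succ k hk ih =>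
    have hs := pSeq_succ r i j k hk hkr
    by_cases h : t ≤ pSeq r i j k
    · exact ih (by omega) h
    · by_cases h' : t = pSeq r i j (k + 1)
      · exact ⟨k + 1, by omega, hkr, Or.inl h'⟩
      · exact ⟨k, hk, by omega, Or.inr ⟨hkr, by omega, by omega⟩⟩

theorem pSeq_eq_add_card (r : ℕ) (i j : ℕ → ℤ) (k : ℕ) (hk : k + 3 ≤ r) :
    pSeq r i j (k + 2) = k + 2 + ((Finset.Icc (r - (k + 1)) (r - 2)).filter
      (fun s => i (s - 1) ≠ i (s + 2) ∧ j (s - 1) ≠ j (s + 2))).card := by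
  induction k with
  | zero =>
    rw [Finset.Icc_eq_empty (by omega)]
    rfl
  | succ k ih =>
    have hI : Finset.Icc (r - (k + 1 + 1)) (r - 2)
        = insert (r - (k + 2)) (Finset.Icc (r - (k + 1)) (r - 2)) := by
      ext s
      simp only [Finset.mem_Icc, Finset.mem_insert]
      omega
    have hn : r - (k + 2) ∉ Finset.Icc (r - (k + 1)) (r - 2) := by
      simp only [Finset.mem_Icc]
      omega
    have e1 : r - (k + 2) - 1 = r - k - 3 := by omega
    have e2 : r - (k + 2) + 2 = r - k := by omega
    rw [pSeq, ih (by omega), if_neg (by omega), hI, Finset.filter_insert, e1, e2]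
    by_cases h : i (r - k) ≠ i (r - k - 3) ∧ j (r - k) ≠ j (r - k - 3)
    · rw [if_pos h, if_pos ⟨h.1.symm, h.2.symm⟩,
        Finset.card_insert_of_notMem (fun hm => hn (Finset.mem_filter.1 hm).1)]
      omega
    · rw [if_neg h, if_neg (fun h' => h ⟨h'.1.symm, h'.2.symm⟩)]
      omega

theorem pSeq_last (r : ℕ) (i j : ℕ → ℤ) (hr : 3 ≤ r) : pSeq r i j r = Nval r i j := by
  obtain ⟨k, rfl⟩ : ∃ k, r = k + 3 := ⟨r - 3, by omega⟩
  have h := pSeq_eq_add_card (k + 3) i j k le_rfl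
  have e : k + 3 - (k + 1) = 2 := by omega
  rw [e] at h
  rw [pSeq, if_pos rfl, h, Nval]
  omega

/-- `S 1 > S 2 > ⋯ > S r` are the turning points of the height function `ξ` on `{1, …, N}`, and
`x m` is the left end point of the interval attached to `S m`. -/
structure Zigzag (r N : ℕ) (ε S : ℕ → ℕ) (x ξ : ℕ → ℤ) : Prop where
  first : S 1 = N
  last : S r = 1
  bounds : ∀ m, 1 ≤ m → m ≤ r → 1 ≤ S m ∧ S m ≤ N
  height : ∀ m, 1 ≤ m → m ≤ r → ξ (S m) = 2 * x m + S m
  step : ∀ m, 1 ≤ m → m + 1 ≤ r →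
    (ε m = 0 ∧ ε (m + 1) = 1 ∧ x (m + 1) = x m) ∨
      (ε m = 1 ∧ ε (m + 1) = 0 ∧ x (m + 1) + S (m + 1) = x m + S m)
  gap : ∀ m, 1 ≤ m → m + 1 ≤ r →
    S m = S (m + 1) + 1 ∨ (S m = S (m + 1) + 2 ∧ 2 ≤ m ∧ m + 2 ≤ r ∧
      2 * ξ (S (m + 1) + 1) = ξ (S m) + ξ (S (m + 1)))
  cover : ∀ t, 1 ≤ t → t ≤ N → ∃ m, 1 ≤ m ∧ m ≤ r ∧ (t = S m ∨
    (m + 1 ≤ r ∧ t = S (m + 1) + 1 ∧ S m = S (m + 1) + 2))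

/-- `[a,b]` is the interval attached to some `1 ≤ t ≤ N`, or its shift by `-1`. -/
def HeightIntv (N : ℕ) (ξ : ℕ → ℤ) (a b : ℤ) : Prop :=
  (∃ t : ℕ, 1 ≤ t ∧ t ≤ N ∧ a = (ξ t - (t : ℤ)) / 2 ∧ b = (ξ t + (t : ℤ)) / 2) ∨
    (∃ t : ℕ, 1 ≤ t ∧ t ≤ N ∧ a = (ξ t - (t : ℤ)) / 2 - 1 ∧ b = (ξ t + (t : ℤ)) / 2 - 1)

/-- `[a,b]` is of the form `[i_p, j_ℓ]` with `ℓ` in the range allowed by `Ĩ`. -/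
def EndPair (r : ℕ) (ε S : ℕ → ℕ) (x : ℕ → ℤ) (a b : ℤ) : Prop :=
  ∃ p ℓ, 1 ≤ p ∧ p ≤ r ∧ 1 ≤ ℓ ∧ ℓ ≤ r ∧
    (ℓ + 1 + ε p = p ∨ ℓ + ε p = p ∨ ℓ + ε p = p + 1 ∨ ℓ + ε p = p + 2) ∧
    a = x p - ε p ∧ b = x ℓ + S ℓ - ε ℓ

namespace Zigzag

variable {r N : ℕ} {ε S : ℕ → ℕ} {x ξ : ℕ → ℤ}

theorem endPair_turning (h : Zigzag r N ε S x ξ) (hr : 3 ≤ r) (m : ℕ) (hm : 1 ≤ m) (hmr : m ≤ r) :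
    EndPair r ε S x (x m) (x m + S m) ∧ EndPair r ε S x (x m - 1) (x m + S m - 1) := by
  have hε : ε m ≤ 1 := by
    rcases Nat.lt_or_ge m r with h1 | h1
    · have := h.step m hm h1
      omega
    · obtain ⟨m, rfl⟩ : ∃ k, m = k + 1 := ⟨m - 1, by omega⟩
      have := h.step m (by omega) hmr
      omega
  have self : EndPair r ε S x (x m - ε m) (x m + S m - ε m) :=
    ⟨m, m, hm, hmr, hm, hmr, by omega, rfl, rfl⟩
  suffices other : EndPair r ε S x (x m - (1 - ε m)) (x m + S m - (1 - ε m)) by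
    rcases Nat.le_one_iff_eq_zero_or_eq_one.1 hε with h0 | h0 <;>
      simp only [h0, Nat.cast_zero, Nat.cast_one, sub_zero, sub_self] at self other
    · exact ⟨self, other⟩
    · exact ⟨other, self⟩
  clear self
  rcases Nat.lt_or_ge 1 m with h1 | h1
  · rcases Nat.lt_or_ge m r with h2 | h2
    · obtain ⟨m, rfl⟩ : ∃ k, m = k + 1 := ⟨m - 1, by omega⟩
      rcases h.step m (by omega) (by omega) with s1 | s1 <;>
        rcases h.step (m + 1) (by omega) (by omega) with s2 | s2
      · omega
      · exact ⟨m, m + 1 + 1, by omega, by omega, by omega, by omega, by omega, by omega, by omega⟩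
      · exact ⟨m + 1 + 1, m, by omega, by omega, by omega, by omega, by omega, by omega, by omega⟩
      · omega
    · obtain ⟨m, rfl⟩ : ∃ k, m = k + 1 + 1 := ⟨m - 2, by omega⟩
      have g := h.gap (m + 1) (by omega) (by omega)
      rcases h.step m (by omega) (by omega) with s1 | s1 <;>
        rcases h.step (m + 1) (by omega) (by omega) with s2 | s2
      · omega
      · exact ⟨m, m + 1, by omega, by omega, by omega, by omega, by omega, by omega, by omega⟩
      · exact ⟨m + 1, m, by omega, by omega, by omega, by omega, by omega, by omega, by omega⟩
      · omega
  · obtain rfl : m = 1 := by omega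
    have g := h.gap 1 (by omega) (by omega)
    rcases h.step 1 (by omega) (by omega) with s1 | s1 <;>
      rcases h.step (1 + 1) (by omega) (by omega) with s2 | s2
    · omega
    · exact ⟨1 + 1, 1 + 1 + 1, by omega, by omega, by omega, by omega, by omega, by omega,
        by omega⟩
    · exact ⟨1 + 1 + 1, 1 + 1, by omega, by omega, by omega, by omega, by omega, by omega,
        by omega⟩
    · omega

theorem endPair_mid (h : Zigzag r N ε S x ξ) (m : ℕ) (hm : 1 ≤ m)
    (hmr : m + 1 ≤ r) (hd : S m = S (m + 1) + 2) (c : ℤ)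
    (hc : ξ (S (m + 1) + 1) = 2 * c + (S (m + 1) + 1)) :
    EndPair r ε S x c (c + (S (m + 1) + 1)) ∧
      EndPair r ε S x (c - 1) (c + (S (m + 1) + 1) - 1) := by
  have g := h.gap m hm hmr
  obtain ⟨m, rfl⟩ : ∃ k, m = k + 1 := ⟨m - 1, by omega⟩
  have x1 := h.height (m + 1) (by omega) (by omega)
  have x2 := h.height (m + 1 + 1) (by omega) (by omega)
  rcases h.step m (by omega) (by omega) with s1 | s1 <;>
    rcases h.step (m + 1) (by omega) (by omega) with s2 | s2 <;>
    rcases h.step (m + 1 + 1) (by omega) (by omega) with s3 | s3 <;>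
    try omega
  · exact ⟨⟨m + 1 + 1 + 1, m + 1 + 1, by omega, by omega, by omega, by omega, by omega, by omega,
      by omega⟩, ⟨m, m + 1, by omega, by omega, by omega, by omega, by omega, by omega, by omega⟩⟩
  · exact ⟨⟨m + 1, m, by omega, by omega, by omega, by omega, by omega, by omega, by omega⟩,
      ⟨m + 1 + 1, m + 1 + 1 + 1, by omega, by omega, by omega, by omega, by omega, by omega,
      by omega⟩⟩

theorem iMem_of_heightIntv (h : Zigzag r N ε S x ξ) (hr : 3 ≤ r) {a b : ℤ}
    (hab : HeightIntv N ξ a b) :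
    IMem N r (fun m => x m - ε m) (fun m => x m + S m - ε m) ε a b := by
  have key : ∀ t : ℕ, 1 ≤ t → t ≤ N → ∃ c : ℤ, ξ t = 2 * c + t ∧
      EndPair r ε S x c (c + t) ∧ EndPair r ε S x (c - 1) (c + t - 1) := by
    intro t ht1 htN
    obtain ⟨m, hm, hmr, rfl | ⟨hmr', rfl, hd⟩⟩ := h.cover t ht1 htN
    · exact ⟨x m, h.height m hm hmr, h.endPair_turning hr m hm hmr⟩
    · have g := h.gap m hm hmr'
      have x1 := h.height m hm hmr
      have x2 := h.height (m + 1) (by omega) hmr'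
      obtain ⟨c, hc⟩ : ∃ c : ℤ, ξ (S (m + 1) + 1) = 2 * c + (S (m + 1) + 1) := by
        rcases h.step m hm hmr' with s | s
        · exact ⟨x m, by omega⟩
        · exact ⟨x m + 1, by omega⟩
      refine ⟨c, by push_cast; exact hc, ?_⟩
      push_cast
      exact h.endPair_mid m hm hmr' hd c hc
  rcases hab with ⟨t, h1, h2, ha, hb⟩ | ⟨t, h1, h2, ha, hb⟩ <;>
    obtain ⟨c, hc, e1, e2⟩ := key t h1 h2
  · obtain rfl : a = c := by omega
    obtain rfl : b = a + t := by omega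
    exact ⟨⟨⟨by omega, by omega⟩, e1⟩, by omega, by omega⟩
  · obtain rfl : a = c - 1 := by omega
    obtain rfl : b = c + t - 1 := by omega
    exact ⟨⟨⟨by omega, by omega⟩, e2⟩, by omega, by omega⟩

theorem heightIntv_of_iMem (h : Zigzag r N ε S x ξ) (hr : 3 ≤ r) {a b : ℤ}
    (hab : IMem N r (fun m => x m - ε m) (fun m => x m + S m - ε m) ε a b) :
    HeightIntv N ξ a b := by
  obtain ⟨⟨⟨hI1, hI2⟩, p, l, hp, hpr, hl, hlr, hpl, ha, hb⟩, hne, hne'⟩ := hab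
  dsimp only at ha hb
  have key : ∀ t : ℕ, (t : ℤ) = b - a → (ξ t = a + b ∨ ξ t = a + b + 2) →
      HeightIntv N ξ a b := by
    rintro t ht (e | e)
    · exact Or.inl ⟨t, by omega, by omega, by omega, by omega⟩
    · exact Or.inr ⟨t, by omega, by omega, by omega, by omega⟩
  have turn : ∀ m, 1 ≤ m → m ≤ r → (S m : ℤ) = b - a → (x m = a ∨ x m = a + 1) →
      HeightIntv N ξ a b := by
    intro m hm hmr hS hx
    have := h.height m hm hmr
    exact key (S m) hS (by omega)
  have below : ∀ m, 1 ≤ m → m ≤ r → (S m : ℤ) = b - a + 1 →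
      (ε m = 0 → x m = a ∨ x m = a + 1) → (ε m = 1 → x m + S m = b ∨ x m + S m = b + 1) →
      HeightIntv N ξ a b := by
    intro m hm hmr hS e0 e1
    have hmr' : m + 1 ≤ r := by
      by_contra hc
      obtain rfl : m = r := by omega
      have := h.last
      omega
    have x1 := h.height m hm hmr
    have x2 := h.height (m + 1) (by omega) hmr'
    have s := h.step m hm hmr'
    rcases h.gap m hm hmr' with g | g
    · exact turn (m + 1) (by omega) hmr' (by omega) (by omega)
    · exact key (S (m + 1) + 1) (by omega) (by omega)
  have above : ∀ m, 1 ≤ m → m ≤ r → (S m : ℤ) = b - a - 1 →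
      (ε m = 1 → x m = a ∨ x m = a + 1) → (ε m = 0 → x m + S m = b ∨ x m + S m = b + 1) →
      HeightIntv N ξ a b := by
    intro m hm hmr hS e0 e1
    have hm' : 1 < m := by
      by_contra hc
      obtain rfl : m = 1 := by omega
      have := h.first
      omega
    obtain ⟨m, rfl⟩ : ∃ k, m = k + 1 := ⟨m - 1, by omega⟩
    have x1 := h.height m (by omega) (by omega)
    have x2 := h.height (m + 1) (by omega) hmr
    have s := h.step m (by omega) hmr
    rcases h.gap m (by omega) hmr with g | g
    · exact turn m (by omega) (by omega) (by omega) (by omega)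
    · exact key (S (m + 1) + 1) (by omega) (by omega)
  have hε : ε p ≤ 1 := by
    rcases Nat.lt_or_ge p r with h1 | h1
    · have := h.step p hp h1
      omega
    · obtain ⟨p, rfl⟩ : ∃ k, p = k + 1 := ⟨p - 1, by omega⟩
      have := h.step p (by omega) hpr
      omega
  rcases Nat.le_one_iff_eq_zero_or_eq_one.1 hε with h0 | h0 <;> rw [h0] at hpl
  · rcases hpl with e | e | e | e
    · obtain rfl : p = l + 1 := by omega
      have s := h.step l (by omega) (by omega)
      exact below (l + 1) (by omega) (by omega) (by omega) (by omega) (by omega)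
    · obtain rfl : p = l := by omega
      exact turn p hp hpr (by omega) (by omega)
    · obtain rfl : l = p + 1 := by omega
      have s := h.step p (by omega) (by omega)
      exact below (p + 1) (by omega) (by omega) (by omega) (by omega) (by omega)
    · obtain rfl : l = p + 1 + 1 := by omega
      have s := h.step p (by omega) (by omega)
      have s' := h.step (p + 1) (by omega) (by omega)
      exact turn (p + 1) (by omega) (by omega) (by omega) (by omega)
  · rcases hpl with e | e | e | e
    · obtain rfl : p = l + 1 + 1 := by omega
      have s := h.step l (by omega) (by omega)
      have s' := h.step (l + 1) (by omega) (by omega)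
      exact turn (l + 1) (by omega) (by omega) (by omega) (by omega)
    · obtain rfl : p = l + 1 := by omega
      have s := h.step l (by omega) (by omega)
      exact above l (by omega) (by omega) (by omega) (by omega) (by omega)
    · obtain rfl : p = l := by omega
      exact turn p hp hpr (by omega) (by omega)
    · obtain rfl : l = p + 1 := by omega
      have s := h.step p (by omega) (by omega)
      exact above p (by omega) (by omega) (by omega) (by omega) (by omega)

end Zigzag

/-- The height function of a prime snake is a zigzag with turning points `s_m`. -/
theorem HeightCond.zigzag {n r : ℕ} (hr : 3 ≤ r) {i j : ℕ → ℤ} {ε : ℕ → ℕ}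
    (hp : IsPrimeSnake n r i j ε) {ξ : ℕ → ℤ}
    (hξ : HeightCond r (Nval r i j) (pSeq r i j) ε ξ) :
    Zigzag r (Nval r i j) ε (sIdx r i j) (fun m => (ξ (sIdx r i j m) - sIdx r i j m) / 2) ξ ∧
      ∀ m, 1 ≤ m → m ≤ r →
        (ξ (sIdx r i j m) + sIdx r i j m) / 2 =
          (ξ (sIdx r i j m) - sIdx r i j m) / 2 + sIdx r i j m := by
  obtain ⟨hlip, hlast, -, hdiff⟩ := hξ
  obtain ⟨⟨⟨-, -, -, halt, -⟩, -⟩, -⟩ := hp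
  have hN : sIdx r i j 1 = Nval r i j := by
    rw [sIdx, Nat.sub_add_cancel (by omega), pSeq_last r i j hr]
  have h1 : sIdx r i j r = 1 := by
    rw [sIdx, Nat.sub_self]
    rfl
  have hS : ∀ m, 1 ≤ m → m ≤ r → 1 ≤ sIdx r i j m ∧ sIdx r i j m ≤ Nval r i j := by
    intro m hm hmr
    rw [← pSeq_last r i j hr]
    exact ⟨pSeq_mono r i j le_rfl (by omega) (by omega),
      pSeq_mono r i j (by omega) (by omega) le_rfl⟩
  have hgap : ∀ m, 1 ≤ m → m + 1 ≤ r → sIdx r i j m = sIdx r i j (m + 1) + 1 ∨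
      (sIdx r i j m = sIdx r i j (m + 1) + 2 ∧ 2 ≤ m ∧ m + 2 ≤ r) := by
    intro m hm hmr
    have e : r - (m + 1) + 1 = r - m := by omega
    have := pSeq_succ r i j (r - m) (by omega) (by omega)
    rw [sIdx, sIdx, e]
    omega
  have hstep : ∀ m, 1 ≤ m → m + 1 ≤ r →
      (ε m = 0 ∧ ε (m + 1) = 1 ∧
        ξ (sIdx r i j m) - ξ (sIdx r i j (m + 1)) = sIdx r i j m - sIdx r i j (m + 1)) ∨
      (ε m = 1 ∧ ε (m + 1) = 0 ∧
        ξ (sIdx r i j (m + 1)) - ξ (sIdx r i j m) = sIdx r i j m - sIdx r i j (m + 1)) := by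
    intro m hm hmr
    have e : r - (m + 1) + 1 = r - m := by omega
    have e' : r - (r - m) = m := by omega
    have hd := hdiff (r - m) (by omega) (by omega)
    have ha := (halt m hm hmr).1
    rw [sIdx, sIdx, e]
    rw [e'] at hd
    have hε : ε m = 0 ∨ ε m = 1 := by omega
    rcases hε with h0 | h0 <;> rw [h0] at hd
    · exact Or.inl ⟨h0, by omega, hd⟩
    · exact Or.inr ⟨h0, by omega, hd⟩
  have hpar : ∀ m, 1 ≤ m → m ≤ r → ∃ c : ℤ, ξ (sIdx r i j m) = 2 * c + sIdx r i j m := by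
    intro m hm
    induction m, hm using Nat.le_induction with
    | base =>
      intro _
      refine ⟨0, ?_⟩
      rw [sIdx, Nat.sub_add_cancel (by omega), hlast]
      ring
    | succ m hm ih =>
      intro hmr
      obtain ⟨c, hc⟩ := ih (by omega)
      rcases hstep m hm hmr with s | s
      · exact ⟨c, by omega⟩
      · exact ⟨c + sIdx r i j m - sIdx r i j (m + 1), by omega⟩
  refine ⟨⟨hN, h1, hS, ?_, ?_, ?_, ?_⟩, ?_⟩
  · intro m hm hmr
    obtain ⟨c, hc⟩ := hpar m hm hmr
    omega
  · intro m hm hmr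
    obtain ⟨c, hc⟩ := hpar m hm (by omega)
    obtain ⟨c', hc'⟩ := hpar (m + 1) (by omega) hmr
    rcases hstep m hm hmr with s | s
    · exact Or.inl ⟨s.1, s.2.1, by omega⟩
    · exact Or.inr ⟨s.1, s.2.1, by omega⟩
  · intro m hm hmr
    rcases hgap m hm hmr with g | g
    · exact Or.inl g
    · refine Or.inr ⟨g.1, g.2.1, g.2.2, ?_⟩
      have b0 := hS m hm (by omega)
      have b1 := hS (m + 1) (by omega) hmr
      have l1 := abs_le.1 (hlip (sIdx r i j (m + 1)) (by omega) (by omega))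
      have l2 := abs_le.1 (hlip (sIdx r i j (m + 1) + 1) (by omega) (by omega))
      have s := hstep m hm hmr
      have e : sIdx r i j (m + 1) + 1 + 1 = sIdx r i j m := by omega
      rw [e] at l2
      omega
  · intro t ht htN
    rw [← pSeq_last r i j hr] at htN
    obtain ⟨l, hl, hlr, hc⟩ := pSeq_cover r i j r (by omega) le_rfl t ht htN
    rcases hc with hc | ⟨hlr', hc, hd⟩
    · refine ⟨r - l + 1, by omega, by omega, Or.inl ?_⟩
      have e : r - (r - l + 1) + 1 = l := by omega
      rw [sIdx, e, hc]
    · refine ⟨r - l, by omega, by omega, Or.inr ⟨by omega, ?_⟩⟩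
      have e : r - (r - l + 1) + 1 = l := by omega
      have e' : r - (r - l) + 1 = l + 1 := by omega
      rw [sIdx, sIdx, e, e']
      exact ⟨hc, hd⟩
  · intro m hm hmr
    obtain ⟨c, hc⟩ := hpar m hm hmr
    omega

theorem IMem_congr {n r : ℕ} {i j i' j' : ℕ → ℤ} {ε : ℕ → ℕ}
    (hi : ∀ m, 1 ≤ m → m ≤ r → i m = i' m) (hj : ∀ m, 1 ≤ m → m ≤ r → j m = j' m) {a b : ℤ}
    (h : IMem n r i j ε a b) : IMem n r i' j' ε a b := by
  obtain ⟨⟨hI, p, l, hp, hpr, hl, hlr, hpl, ha, hb⟩, hne⟩ := h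
  exact ⟨⟨hI, p, l, hp, hpr, hl, hlr, hpl, ha.trans (hi p hp hpr), hb.trans (hj l hl hlr)⟩, hne⟩

/-- `{[i^ξ_t, j^ξ_t] : 1 ≤ t ≤ N} ∪ {[i^ξ_t - 1, j^ξ_t - 1] : 1 ≤ t ≤ N} = 𝕀_N(𝐬_ξ)`. -/
theorem stmt18 (n r : ℕ) (hn : 1 ≤ n) (hr : 3 ≤ r) (i j : ℕ → ℤ) (ε : ℕ → ℕ)
    (hp : IsPrimeSnake n r i j ε)
    (ξ : ℕ → ℤ) (hξ : HeightCond r (Nval r i j) (pSeq r i j) ε ξ) :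
    ∀ a b : ℤ,
      ((∃ t : ℕ, 1 ≤ t ∧ t ≤ Nval r i j ∧
          a = (ξ t - (t : ℤ)) / 2 ∧ b = (ξ t + (t : ℤ)) / 2) ∨
       (∃ t : ℕ, 1 ≤ t ∧ t ≤ Nval r i j ∧
          a = (ξ t - (t : ℤ)) / 2 - 1 ∧ b = (ξ t + (t : ℤ)) / 2 - 1)) ↔
      IMem (Nval r i j) r (iPr r i j ε ξ) (jPr r i j ε ξ) ε a b := by
  intro a b
  obtain ⟨hz, hj⟩ := hξ.zigzag hr hp
  have hj' : ∀ m, 1 ≤ m → m ≤ r → jPr r i j ε ξ m =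
      (ξ (sIdx r i j m) - sIdx r i j m) / 2 + sIdx r i j m - ε m := fun m hm hmr => by
    rw [jPr, hj m hm hmr]
  constructor
  · intro h
    exact IMem_congr (fun _ _ _ => rfl) (fun m hm hmr => (hj' m hm hmr).symm)
      (hz.iMem_of_heightIntv hr h)
  · intro h
    exact hz.heightIntv_of_iMem hr (IMem_congr (fun _ _ _ => rfl) hj' h)
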